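/- (Appendix A, gradient of the Doppler with respect to the receiver position.) Fix q and w in EuclideanSpace ℝ (Fin 3) (the satellite position and the relative velocity w = v_B − v_U). Then at every p ≠ q, the Doppler map ν(p) := ⟪(p − q)/‖p − q‖, w⟫ is differentiable, and its gradient at p equals (1/‖p − q‖) • (w − ⟪u, w⟫ • u), where u := (p − q)/‖p − q‖ is the unit direction vector; i.e., the gradient is the component of the relative velocity orthogonal to the line of sight, divided by the range. -/

import Mathlib

open scoped RealInnerProductSpace

/-- Away from `0`, the norm of a real inner product space has gradient `‖x‖⁻¹ • x`. -/
theorem hasFDerivAt_norm_of_ne_zero {E : Type*} [NormedAddCommGroup E] [InnerProductSpace ℝ E]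
    {x : E} (hx : x ≠ 0) : HasFDerivAt (fun y : E => ‖y‖) (‖x‖⁻¹ • innerSL ℝ x) x := by
  have h := (hasStrictFDerivAt_norm_sq x).hasFDerivAt.sqrt (by simpa using hx)
  simp only [Real.sqrt_sq (norm_nonneg _)] at h
  convert h using 1
  ext y
  simp
  ring

/-- Appendix A: the gradient of the Doppler `ν(p) = ⟪(p - q)/‖p - q‖, w⟫` with respect to
the receiver position `p`, at any `p ≠ q`, equals the component of the relative velocity
`w` orthogonal to the line of sight, divided by the range:
`(1/‖p - q‖) • (w - ⟪u, w⟫ • u)` with `u = (p - q)/‖p - q‖`; in particular `ν` is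
differentiable at `p`. -/
theorem gradient_doppler_position (q w p : EuclideanSpace ℝ (Fin 3)) (hp : p ≠ q) :
    HasGradientAt
      (fun x : EuclideanSpace ℝ (Fin 3) => (⟪(‖x - q‖)⁻¹ • (x - q), w⟫ : ℝ))
      ((‖p - q‖)⁻¹ •
        (w - (⟪(‖p - q‖)⁻¹ • (p - q), w⟫ : ℝ) • ((‖p - q‖)⁻¹ • (p - q)))) p := by
  have hr : p - q ≠ 0 := sub_ne_zero.mpr hp
  have hn : ‖p - q‖ ≠ 0 := norm_ne_zero_iff.mpr hr
  have hsub : HasFDerivAt (fun x : EuclideanSpace ℝ (Fin 3) => x - q)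
      (ContinuousLinearMap.id ℝ _) p := (hasFDerivAt_id p).sub_const q
  have hinv := (hasDerivAt_inv hn).comp_hasFDerivAt p
    ((hasFDerivAt_norm_of_ne_zero hr).comp p hsub)
  rw [hasGradientAt_iff_hasFDerivAt]
  refine ((hinv.smul hsub).inner ℝ (hasFDerivAt_const w p)).congr_fderiv ?_
  ext y
  simp [inner_sub_left, inner_add_left, real_inner_smul_left, real_inner_comm w y]
  field_simp
  ring
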